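/- arXiv:2202.08799 — 3 statements merged into one kernel-verified Lean document; each statement's English description precedes it below -/
import Mathlib

section
/- (Observation on innermost sets) Let n ≥ 1 and let F ⊆ {0, …, n−1} be a nonempty innermost set which is not the unique maximal innermost set (i.e., if n is odd then F ≠ {0, 2, 4, …, n−1}). Then there exists an integer i with 0 ≤ i ≤ n such that either (i−1 ∉ F and i+1 ∈ F) or (i ∉ F and i−2 ∈ F). -/
open CategoryTheory

/-- A set `F` of generator indices is *innermost* if its elements are pairwise at distance
at least `2`, i.e. `|i - j| ≥ 2` for all distinct `i, j ∈ F`. -/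
def Innermost (n : ℕ) (F : Finset (Fin n)) : Prop :=
  ∀ i ∈ F, ∀ j ∈ F, i ≠ j → 2 ≤ ((i : ℤ) - (j : ℤ)).natAbs

/-- The set `{0, 2, 4, …}` of even indices in `{0, …, n-1}`; for `n` odd this is the unique
maximal innermost set `M = {0, 2, …, n-1}`. -/
def Mset (n : ℕ) : Finset (Fin n) := Finset.univ.filter (fun i : Fin n => (i : ℕ) % 2 = 0)

/-- Membership of an integer in a set `F ⊆ {0, …, n-1}` of indices. -/
def memI {n : ℕ} (F : Finset (Fin n)) (j : ℤ) : Prop := ∃ k ∈ F, (k : ℤ) = j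

/-- **Observation.** If `F ⊆ {0, …, n-1}` is a nonempty innermost set which is not the unique
maximal innermost set (for `n` odd, `F ≠ {0, 2, …, n-1}`; for `n` even the extra hypothesis is
vacuous), then there is an index `0 ≤ i ≤ n` such that either `i-1 ∉ F` and `i+1 ∈ F`, or
`i ∉ F` and `i-2 ∈ F` (membership being interpreted in the integers). -/
theorem innermost_observation (n : ℕ) (hn : 1 ≤ n) (F : Finset (Fin n)) (hne : F.Nonempty)
    (hF : Innermost n F) (hmax : Odd n → F ≠ Mset n) :
    ∃ i : ℤ, 0 ≤ i ∧ i ≤ n ∧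
      ((¬ memI F (i - 1) ∧ memI F (i + 1)) ∨ (¬ memI F i ∧ memI F (i - 2))) := by
  by_contra hcon
  have H1 : ∀ i : ℤ, 0 ≤ i → i ≤ n → memI F (i + 1) → memI F (i - 1) := by
    intro i h0 h1 h2
    by_contra h3
    exact hcon ⟨i, h0, h1, Or.inl ⟨h3, h2⟩⟩
  have H2 : ∀ i : ℤ, 0 ≤ i → i ≤ n → memI F (i - 2) → memI F i := by
    intro i h0 h1 h2
    by_contra h3
    exact hcon ⟨i, h0, h1, Or.inr ⟨h3, h2⟩⟩
  have B : ∀ j : ℤ, memI F j → 0 ≤ j ∧ j < n := by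
    rintro j ⟨k, -, rfl⟩
    have := k.isLt
    omega
  have D : ∀ m : ℕ, memI F (m : ℤ) → m % 2 = 0 ∧ memI F 0 := by
    intro m
    induction m using Nat.strong_induction_on with
    | _ m ih =>
      intro hm
      by_cases h0 : m = 0
      · subst h0
        exact ⟨rfl, by simpa using hm⟩
      · have hb := B _ hm
        have h2 := H1 ((m : ℤ) - 1) (by omega) (by omega) (by simpa using hm)
        have hb2 := B _ h2
        have e : (m : ℤ) - 1 - 1 = ((m - 2 : ℕ) : ℤ) := by omega
        rw [e] at h2
        have h3 := ih (m - 2) (by omega) h2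
        exact ⟨by omega, h3.2⟩
  obtain ⟨k, hk⟩ := hne
  have hz : memI F 0 := (D k ⟨k, hk, rfl⟩).2
  have U : ∀ m : ℕ, 2 * m ≤ n → memI F ((2 * m : ℕ) : ℤ) := by
    intro m
    induction m with
    | zero => intro _; simpa using hz
    | succ m ih =>
      intro h
      apply H2 _ (by omega) (by omega)
      have e : ((2 * (m + 1) : ℕ) : ℤ) - 2 = ((2 * m : ℕ) : ℤ) := by omega
      rw [e]
      exact ih (by omega)
  rcases Nat.even_or_odd n with he | ho
  · obtain ⟨m, hm⟩ := he
    have := B _ (U m (by omega))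
    omega
  · apply hmax ho
    ext x
    simp only [Mset, Finset.mem_filter, Finset.mem_univ, true_and]
    constructor
    · intro hx
      exact (D x ⟨x, hx, rfl⟩).1
    · intro hx
      have hlt := x.isLt
      obtain ⟨y, hy, hyx⟩ := U ((x : ℕ) / 2) (by omega)
      have : y = x := by
        apply Fin.ext
        omega
      exact this ▸ hy
end

section
/- (Proposition: retraction between cup modules) Let F ⊆ {0, …, n−1} be a nonempty innermost set, and suppose i is an integer with 0 ≤ i ≤ n and s ∈ F are such that either (i−1 ∉ F and s = i+1 ∈ F) or (i ∉ F and s = i−2 ∈ F). Set F_s = F ∖ {s}. Then the inclusion cup(F) ↪ cup(F_s) is a retract of left TL_{n+1}(a)-modules: the map cup(F_s) → cup(F) given by right multiplication c ↦ c·(U_{i−1}U_{i−2}) in the second case, respectively c ↦ c·(U_iU_{i+1}) in the first case, is a well-defined morphism of left TL_{n+1}(a)-modules whose composite with the inclusion cup(F) ↪ cup(F_s) is the identity of cup(F). -/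
open CategoryTheory

/-- The defining relations of the Temperley–Lieb algebra on `n+1` strands (with `n` generators
`U_0, …, U_{n-1}`), inside the free algebra on `Fin n`. -/
inductive TLRel (R : Type) [CommRing R] (a : R) (n : ℕ) :
    FreeAlgebra R (Fin n) → FreeAlgebra R (Fin n) → Prop
  | comm (i j : Fin n) (h : (i : ℕ) + 2 ≤ j ∨ (j : ℕ) + 2 ≤ i) :
      TLRel R a n (FreeAlgebra.ι R i * FreeAlgebra.ι R j)
        (FreeAlgebra.ι R j * FreeAlgebra.ι R i)
  | braid (i j : Fin n) (h : (i : ℕ) = (j : ℕ) + 1 ∨ (j : ℕ) = (i : ℕ) + 1) :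
      TLRel R a n (FreeAlgebra.ι R i * FreeAlgebra.ι R j * FreeAlgebra.ι R i)
        (FreeAlgebra.ι R i)
  | idem (i : Fin n) :
      TLRel R a n (FreeAlgebra.ι R i * FreeAlgebra.ι R i) (a • FreeAlgebra.ι R i)

/-- The Temperley–Lieb algebra `TL_{n+1}(a)` on `n+1` strands: the quotient of the free
`R`-algebra on `n` generators by the Temperley–Lieb relations. -/
abbrev TL (R : Type) [CommRing R] (a : R) (n : ℕ) : Type := RingQuot (TLRel R a n)

variable (R : Type) [CommRing R] (a : R) (n : ℕ)

/-- The generators `U_i` of the Temperley–Lieb algebra. -/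
noncomputable def U (i : Fin n) : TL R a n :=
  RingQuot.mkAlgHom R (TLRel R a n) (FreeAlgebra.ι R i)

/-- The product `∏_{i ∈ F} U_i`, taken in increasing order of the indices (for an innermost
set `F` the factors pairwise commute, so the order is immaterial). -/
noncomputable def cupGen (F : Finset (Fin n)) : TL R a n :=
  ((F.sort (· ≤ ·)).map (U R a n)).prod

/-- The cup module `cup(F)`: the left ideal of `TL` generated by `∏_{i ∈ F} U_i`.
In particular `cup(∅) = TL`. -/
noncomputable def cup (F : Finset (Fin n)) : Submodule (TL R a n) (TL R a n) :=
  Submodule.span (TL R a n) {cupGen R a n F}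

theorem U_commute (i j : Fin n) (h : (i : ℕ) + 2 ≤ j ∨ (j : ℕ) + 2 ≤ i) :
    Commute (U R a n i) (U R a n j) := by
  have := RingQuot.mkAlgHom_rel R (TLRel.comm (R := R) (a := a) i j h)
  simpa [U, Commute, SemiconjBy] using this

theorem U_braid (i j : Fin n) (h : (i : ℕ) = (j : ℕ) + 1 ∨ (j : ℕ) = (i : ℕ) + 1) :
    U R a n i * U R a n j * U R a n i = U R a n i := by
  have := RingQuot.mkAlgHom_rel R (TLRel.braid (R := R) (a := a) i j h)
  simpa [U] using this

theorem innermost_commute (F : Finset (Fin n)) (hF : Innermost n F) (i j : Fin n)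
    (hi : i ∈ F) (hj : j ∈ F) : Commute (U R a n i) (U R a n j) := by
  by_cases hij : i = j
  · subst hij
    exact Commute.refl _
  · have := hF i hi j hj hij
    exact U_commute R a n i j (by omega)

theorem commute_cupGen (F : Finset (Fin n)) (x : TL R a n)
    (h : ∀ k ∈ F, Commute x (U R a n k)) : Commute x (cupGen R a n F) := by
  unfold cupGen
  apply Commute.list_prod_right
  intro y hy
  obtain ⟨k, hk, rfl⟩ := List.mem_map.1 hy
  exact h k (by simpa using hk)

theorem cupGen_erase (F : Finset (Fin n)) (hF : Innermost n F) (s : Fin n) (hs : s ∈ F) :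
    cupGen R a n F = U R a n s * cupGen R a n (F.erase s) := by
  unfold cupGen
  rw [← List.prod_cons, ← List.map_cons]
  apply List.Perm.prod_eq'
  · apply List.Perm.map
    rw [← Multiset.coe_eq_coe, ← Multiset.cons_coe, Finset.sort_eq, Finset.sort_eq,
      Finset.erase_val]
    exact (Multiset.cons_erase hs).symm
  · rw [List.pairwise_map]
    apply List.pairwise_of_forall_mem_list
    intro i hi j hj
    exact innermost_commute R a n F hF i j (by simpa using hi) (by simpa using hj)

/-- **Proposition (retraction between cup modules).** Let `F` be a nonempty innermost set and
suppose `0 ≤ i ≤ n` and `s ∈ F` satisfy either (`i-1 ∉ F` and `s = i+1 ∈ F`), or (`i ∉ F` and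
`s = i-2 ∈ F`).  Writing `t = i` in the first case and `t = i-1` in the second (so that the
hypotheses become `t+1 = s` together with `t-1 ∉ F`, resp. `s+1 = t` together with
`t+1 ∉ F`), the inclusion `cup(F) ↪ cup(F∖{s})` is a retract of left `TL_{n+1}(a)`-modules:
right multiplication by `U_t·U_s` (which is `U_i·U_{i+1}`, resp. `U_{i-1}·U_{i-2}`) maps
`cup(F∖{s})` into `cup(F)`, is left `TL`-linear, and restricts to the identity on `cup(F)`. -/
theorem cup_retraction (hn : 1 ≤ n) (F : Finset (Fin n)) (hne : F.Nonempty)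
    (hF : Innermost n F) (s t : Fin n) (hs : s ∈ F)
    (hcase : ((t : ℕ) + 1 = (s : ℕ) ∧ ¬ memI F ((t : ℤ) - 1)) ∨
      ((s : ℕ) + 1 = (t : ℕ) ∧ ¬ memI F ((t : ℤ) + 1))) :
    cup R a n F ≤ cup R a n (F.erase s) ∧
    (∀ c ∈ cup R a n (F.erase s), c * (U R a n t * U R a n s) ∈ cup R a n F) ∧
    (∀ c ∈ cup R a n F, c * (U R a n t * U R a n s) = c) := by
  have hst : (s : ℕ) = (t : ℕ) + 1 ∨ (t : ℕ) = (s : ℕ) + 1 := by omega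
  have hG := cupGen_erase R a n F hF s hs
  have hcs : Commute (U R a n s) (cupGen R a n (F.erase s)) :=
    commute_cupGen R a n _ _ fun k hk =>
      innermost_commute R a n F hF s k hs (Finset.mem_of_mem_erase hk)
  have hct : Commute (U R a n t) (cupGen R a n (F.erase s)) := by
    refine commute_cupGen R a n _ _ fun k hk => ?_
    obtain ⟨hks, hkF⟩ := Finset.mem_erase.1 hk
    have h1 := hF k hkF s hs hks
    apply U_commute
    rcases hcase with ⟨h2, h3⟩ | ⟨h2, h3⟩
    · have h4 : (k : ℤ) ≠ (t : ℤ) - 1 := fun h => h3 ⟨k, hkF, h⟩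
      omega
    · have h4 : (k : ℤ) ≠ (t : ℤ) + 1 := fun h => h3 ⟨k, hkF, h⟩
      omega
  refine ⟨?_, ?_, ?_⟩
  · unfold cup
    rw [Submodule.span_singleton_le_iff_mem, Submodule.mem_span_singleton]
    exact ⟨U R a n s, by rw [hG, smul_eq_mul]⟩
  · intro c hc
    obtain ⟨x, rfl⟩ := Submodule.mem_span_singleton.1 hc
    refine Submodule.mem_span_singleton.2 ⟨x * U R a n t, ?_⟩
    rw [hG, hcs.eq, smul_eq_mul, smul_eq_mul, mul_assoc, mul_assoc, ← mul_assoc (U R a n t),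
      hct.eq, mul_assoc]
  · intro c hc
    obtain ⟨x, rfl⟩ := Submodule.mem_span_singleton.1 hc
    rw [hG, hcs.eq, smul_eq_mul, mul_assoc, mul_assoc, ← mul_assoc (U R a n s),
      U_braid R a n s t hst]
end

section
/- (Key step in proof of Theorem C) Suppose n is odd, let M = {0, 2, 4, …, n−1} be the unique maximal innermost set, and set M_0 = M ∖ {0}. Then right multiplication by U_0 defines a well-defined morphism of left TL_{n+1}(a)-modules cup(M_0) → cup(M), c ↦ c·U_0, and its composite with the inclusion cup(M) ↪ cup(M_0) is scalar multiplication by a on cup(M). -/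
open CategoryTheory

variable (R : Type) [CommRing R] (a : R) (n : ℕ)

/-- **Key step in the proof of Theorem C.** Suppose `n` is odd, let `M = {0, 2, …, n-1}` be
the unique maximal innermost set and `M₀ = M ∖ {0}`.  Then `cup(M) ⊆ cup(M₀)`, right
multiplication by `U_0` maps `cup(M₀)` into `cup(M)` (so it defines a morphism of left
`TL_{n+1}(a)`-modules `cup(M₀) → cup(M)`), and its composite with the inclusion
`cup(M) ↪ cup(M₀)` is scalar multiplication by `a` on `cup(M)`. -/
theorem cup_Mset_mul_U0 (hn : 1 ≤ n) (hodd : Odd n) :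
    cup R a n (Mset n) ≤ cup R a n ((Mset n).erase ⟨0, hn⟩) ∧
    (∀ c ∈ cup R a n ((Mset n).erase ⟨0, hn⟩), c * U R a n ⟨0, hn⟩ ∈ cup R a n (Mset n)) ∧
    (∀ c ∈ cup R a n (Mset n), c * U R a n ⟨0, hn⟩ = a • c) := by
  have hidem : U R a n ⟨0, hn⟩ * U R a n ⟨0, hn⟩ = a • U R a n ⟨0, hn⟩ := by
    have h := RingQuot.mkAlgHom_rel R (TLRel.idem (R := R) (a := a) (n := n) ⟨0, hn⟩)
    rw [map_mul, map_smul] at h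
    exact h
  have hmem : (⟨0, hn⟩ : Fin n) ∈ Mset n := by simp [Mset]
  have hgen : cupGen R a n (Mset n) =
      U R a n ⟨0, hn⟩ * cupGen R a n ((Mset n).erase ⟨0, hn⟩) := by
    unfold cupGen
    conv_lhs => rw [← Finset.insert_erase hmem]
    rw [Finset.sort_insert _ (fun b _ => Fin.mk_le_of_le_val (Nat.zero_le _))
      (Finset.notMem_erase _ _)]
    simp
  have hcomm : Commute (U R a n ⟨0, hn⟩) (cupGen R a n ((Mset n).erase ⟨0, hn⟩)) := by
    unfold cupGen
    apply Commute.list_prod_right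
    intro x hx
    obtain ⟨i, hi, rfl⟩ := List.mem_map.1 hx
    rw [Finset.mem_sort, Finset.mem_erase] at hi
    obtain ⟨h0, hM⟩ := hi
    have h2 : (i : ℕ) % 2 = 0 := by simpa [Mset] using hM
    have h0' : (i : ℕ) ≠ 0 := fun h => h0 (Fin.ext h)
    have h := RingQuot.mkAlgHom_rel R (TLRel.comm (R := R) (a := a) (n := n) ⟨0, hn⟩ i
      (Or.inl (by change 0 + 2 ≤ (i : ℕ); omega)))
    rw [map_mul, map_mul] at h
    exact h
  refine ⟨?_, ?_, ?_⟩
  · unfold cup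
    rw [Submodule.span_singleton_le_iff_mem, Submodule.mem_span_singleton]
    exact ⟨U R a n ⟨0, hn⟩, by rw [hgen, smul_eq_mul]⟩
  · intro c hc
    obtain ⟨t, rfl⟩ := Submodule.mem_span_singleton.1 hc
    refine Submodule.mem_span_singleton.2 ⟨t, ?_⟩
    rw [hgen, hcomm.eq, smul_eq_mul, smul_eq_mul, mul_assoc]
  · intro c hc
    obtain ⟨t, rfl⟩ := Submodule.mem_span_singleton.1 hc
    rw [hgen, hcomm.eq, smul_eq_mul, mul_assoc, mul_assoc, hidem, mul_smul_comm, mul_smul_comm]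
end
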